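/- Let ε ∈ (0,1/2). Suppose Ũθ and Ṽθ are C¹ on (−1,1), C³ on (−1/2,1/2), with finite doubly-log M₁-norms, and Ũφ, Ṽφ ∈ C²(−1,1) have finite M₂-norms. Then ψ[Ũφ,Ṽφ] extends continuously to [−1,1]; define Qθ(x) = ½Ũθ(x)Ṽθ(x) + ψ[Ũφ,Ṽφ](x) − ½(1−x)ψ[Ũφ,Ṽφ](−1) − ½(1+x)ψ[Ũφ,Ṽφ](1) + ¼(ŨθṼθ)''(0)(1−x²) and Qφ(x) = Ũθ(x)Ṽφ'(x). Then Qθ(x) → 0 as x → ±1, Qθ''(0) = 0, and there exists C depending only on ε such that the doubly-log N₁-norm of Qθ plus the N₂-norm of Qφ is at most C·(doubly-log M₁-norm of Ũθ + M₂-norm of Ũφ)·(doubly-log M₁-norm of Ṽθ + M₂-norm of Ṽφ). -/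

import Mathlib

open Set Filter

theorem hasDerivAt_integral_of_continuousOn_Ioo {f : ℝ → ℝ} (hf : ContinuousOn f (Ioo (-1) 1))
    {t : ℝ} (ht : t ∈ Ioo (-1 : ℝ) 1) :
    HasDerivAt (fun x => ∫ s in (0:ℝ)..x, f s) (f t) t := by
  have hsub : uIcc 0 t ⊆ Ioo (-1 : ℝ) 1 :=
    ordConnected_Ioo.uIcc_subset (by norm_num) ht
  exact intervalIntegral.integral_hasDerivAt_right (hf.mono hsub).intervalIntegrable
    (hf.stronglyMeasurableAtFilter isOpen_Ioo t ht) (hf.continuousAt (isOpen_Ioo.mem_nhds ht))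

theorem abs_integral_le_rpow_of_nonneg {f : ℝ → ℝ} {K q : ℝ} (hK : 0 ≤ K) (hq : 0 < q)
    (hf : ∀ s ∈ Ico (0 : ℝ) 1, |f s| ≤ K * (1 - s) ^ (-(1 + q))) {t : ℝ}
    (ht : t ∈ Ico (0 : ℝ) 1) :
    |∫ s in (0:ℝ)..t, f s| ≤ K / q * (1 - t) ^ (-q) := by
  have hne : ∀ s ∈ uIcc 0 t, 1 - s ≠ 0 := by
    intro s hs
    rw [uIcc_of_le ht.1] at hs
    linarith [hs.2, ht.2]
  have hcont : ContinuousOn (fun s : ℝ => K * (1 - s) ^ (-(1 + q))) (uIcc 0 t) :=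
    continuousOn_const.mul
      ((continuousOn_const.sub continuousOn_id).rpow_const fun s hs => Or.inl (hne s hs))
  have hder : ∀ s ∈ uIcc 0 t, HasDerivAt (fun s : ℝ => K / q * (1 - s) ^ (-q))
      (K * (1 - s) ^ (-(1 + q))) s := by
    intro s hs
    have h := (((hasDerivAt_id s).const_sub 1).rpow_const (p := -q)
      (Or.inl (hne s hs))).const_mul (K / q)
    refine h.congr_deriv ?_
    rw [show -q - 1 = -(1 + q) by ring]
    simp only [id]
    field_simp
  have key : ‖∫ s in (0:ℝ)..t, f s‖ ≤ ∫ s in (0:ℝ)..t, K * (1 - s) ^ (-(1 + q)) :=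
    intervalIntegral.norm_integral_le_of_norm_le ht.1
      (Eventually.of_forall fun s hs => hf s ⟨hs.1.le, hs.2.trans_lt ht.2⟩)
      hcont.intervalIntegrable
  rw [intervalIntegral.integral_eq_sub_of_hasDerivAt hder hcont.intervalIntegrable,
    Real.norm_eq_abs] at key
  have : 0 ≤ K / q * (1 - 0) ^ (-q) := by
    norm_num
    positivity
  linarith

theorem abs_integral_le_rpow {f : ℝ → ℝ} {K q : ℝ} (hK : 0 ≤ K) (hq : 0 < q)
    (hf : ∀ s ∈ Ioo (-1 : ℝ) 1, |f s| ≤ K * (1 - |s|) ^ (-(1 + q))) {t : ℝ}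
    (ht : t ∈ Ioo (-1 : ℝ) 1) :
    |∫ s in (0:ℝ)..t, f s| ≤ K / q * (1 - |t|) ^ (-q) := by
  rcases le_total 0 t with h0 | h0
  · rw [abs_of_nonneg h0]
    refine abs_integral_le_rpow_of_nonneg hK hq (fun s hs => ?_) ⟨h0, ht.2⟩
    have := hf s ⟨by linarith [hs.1], hs.2⟩
    rwa [abs_of_nonneg hs.1] at this
  · rw [abs_of_nonpos h0]
    have := abs_integral_le_rpow_of_nonneg (f := fun s => f (-s)) (t := -t) hK hq
      (fun s hs => ?_) ⟨by linarith, by linarith [ht.1]⟩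
    · rwa [intervalIntegral.integral_comp_neg, neg_neg, neg_zero,
        intervalIntegral.integral_symm, abs_neg] at this
    · have := hf (-s) ⟨by linarith [hs.2], by linarith [hs.1]⟩
      rwa [abs_neg, abs_of_nonneg hs.1] at this

theorem intervalIntegrable_one_sub_rpow {a : ℝ} (ha : a < 1) (x y : ℝ) :
    IntervalIntegrable (fun s : ℝ => (1 - s) ^ (-a)) MeasureTheory.volume x y := by
  have := (intervalIntegral.intervalIntegrable_rpow' (a := 1 - x) (b := 1 - y) (r := -a)
    (by linarith)).comp_sub_left 1
  simpa using this

theorem abs_integral_to_one_le_rpow {f : ℝ → ℝ} {K a : ℝ} (ha : a < 1)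
    (hf : ∀ s ∈ Ico (0 : ℝ) 1, |f s| ≤ K * (1 - s) ^ (-a)) {x : ℝ}
    (hx : x ∈ Ico (0 : ℝ) 1) :
    |∫ s in x..1, f s| ≤ K / (1 - a) * (1 - x) ^ (1 - a) := by
  have key : ‖∫ s in x..1, f s‖ ≤ ∫ s in x..1, K * (1 - s) ^ (-a) := by
    refine intervalIntegral.norm_integral_le_of_norm_le hx.2.le ?_
      ((intervalIntegrable_one_sub_rpow ha x 1).const_mul K)
    filter_upwards [MeasureTheory.Measure.ae_ne MeasureTheory.volume (1 : ℝ)] with s hs1 hs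
    exact hf s ⟨hx.1.trans hs.1.le, lt_of_le_of_ne hs.2 hs1⟩
  have hval : ∫ s in x..1, (1 - s) ^ (-a) = (1 - x) ^ (1 - a) / (1 - a) := by
    rw [intervalIntegral.integral_comp_sub_left (fun s : ℝ => s ^ (-a)) 1,
      integral_rpow (Or.inl (by linarith))]
    rw [sub_self, Real.zero_rpow (by linarith), sub_zero, neg_add_eq_sub]
  rw [intervalIntegral.integral_const_mul, hval, Real.norm_eq_abs] at key
  exact key.trans_eq (by ring)

theorem intervalIntegrable_of_le_rpow {f : ℝ → ℝ} {K a : ℝ} (hK : 0 ≤ K) (ha : a < 1)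
    (hc : ContinuousOn f (Ioo (-1) 1))
    (hf : ∀ s ∈ Ioo (-1 : ℝ) 1, |f s| ≤ K * (1 - |s|) ^ (-a)) :
    IntervalIntegrable f MeasureTheory.volume (-1) 1 := by
  have h1 := intervalIntegrable_one_sub_rpow ha (-1) 1
  have h2 : IntervalIntegrable (fun s : ℝ => (1 - -s) ^ (-a)) MeasureTheory.volume (-1) 1 := by
    rw [IntervalIntegrable.iff_comp_neg]
    simpa only [neg_neg] using h1.symm
  have h3 := (h1.add h2).const_mul K
  rw [intervalIntegrable_iff_integrableOn_Ioo_of_le (by norm_num)] at h3 ⊢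
  refine h3.mono' (hc.aestronglyMeasurable measurableSet_Ioo) ?_
  filter_upwards [MeasureTheory.ae_restrict_mem measurableSet_Ioo] with s hs
  refine (hf s hs).trans (mul_le_mul_of_nonneg_left ?_ hK)
  have p1 : 0 ≤ (1 - s) ^ (-a) := Real.rpow_nonneg (by linarith [hs.2]) _
  have p2 : 0 ≤ (1 - -s) ^ (-a) := Real.rpow_nonneg (by linarith [hs.1]) _
  rcases abs_choice s with h | h <;> rw [h] <;> linarith

theorem abs_sub_linear_interpolation_le {f : ℝ → ℝ} {K a : ℝ} (hK : 0 ≤ K) (ha0 : 0 ≤ a)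
    (ha : a < 1) (hi : IntervalIntegrable f MeasureTheory.volume (-1) 1)
    (hf : ∀ s ∈ Ioo (-1 : ℝ) 1, |f s| ≤ K * (1 - |s|) ^ (-a)) {F : ℝ → ℝ}
    (hF : ∀ x, F x = ∫ s in (0:ℝ)..x, f s) :
    |F 1| ≤ K / (1 - a) ∧ |F (-1)| ≤ K / (1 - a) ∧ ∀ x ∈ Ioo (-1 : ℝ) 1,
      |F x - F (-1) * (1 - x) / 2 - F 1 * (1 + x) / 2| ≤
        2 * (K / (1 - a)) * (1 - |x|) ^ (1 - a) := by
  have hfr : ∀ s ∈ Ico (0 : ℝ) 1, |f s| ≤ K * (1 - s) ^ (-a) := fun s hs => by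
    have := hf s ⟨by linarith [hs.1], hs.2⟩
    rwa [abs_of_nonneg hs.1] at this
  have hfl : ∀ s ∈ Ico (0 : ℝ) 1, |f (-s)| ≤ K * (1 - s) ^ (-a) := fun s hs => by
    have := hf (-s) ⟨by linarith [hs.2], by linarith [hs.1]⟩
    rwa [abs_neg, abs_of_nonneg hs.1] at this
  have hint : ∀ x ∈ Icc (-1 : ℝ) 1, ∀ y ∈ Icc (-1 : ℝ) 1,
      IntervalIntegrable f MeasureTheory.volume x y := fun x hx y hy =>
    hi.mono_set (by
      rw [uIcc_of_le (by norm_num : (-1 : ℝ) ≤ 1)]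
      exact ordConnected_Icc.uIcc_subset hx hy)
  have m0 : (0 : ℝ) ∈ Icc (-1 : ℝ) 1 := by norm_num
  have m1 : (1 : ℝ) ∈ Icc (-1 : ℝ) 1 := by norm_num
  have hR : ∀ x ∈ Ico (0 : ℝ) 1, |F x - F 1| ≤ K / (1 - a) * (1 - x) ^ (1 - a) := by
    intro x hx
    have hx' : x ∈ Icc (-1 : ℝ) 1 := ⟨by linarith [hx.1], hx.2.le⟩
    rw [abs_sub_comm, hF, hF,
      intervalIntegral.integral_interval_sub_left (hint _ m0 _ m1) (hint _ m0 _ hx')]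
    exact abs_integral_to_one_le_rpow ha hfr hx
  have hFneg : ∀ x, F (-x) = -∫ s in (0:ℝ)..x, f (-s) := by
    intro x
    rw [hF, intervalIntegral.integral_comp_neg, neg_zero, ← intervalIntegral.integral_symm]
  have hL : ∀ x ∈ Ico (0 : ℝ) 1, |F (-x) - F (-1)| ≤ K / (1 - a) * (1 - x) ^ (1 - a) := by
    intro x hx
    have hm1 : (-1 : ℝ) ∈ Icc (-1 : ℝ) 1 := by norm_num
    have hx' : -x ∈ Icc (-1 : ℝ) 1 := ⟨by linarith [hx.2], by linarith [hx.1]⟩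
    rw [hF, hF,
      intervalIntegral.integral_interval_sub_left (hint _ m0 _ hx') (hint _ m0 _ hm1)]
    have := abs_integral_to_one_le_rpow ha hfl hx
    rwa [intervalIntegral.integral_comp_neg] at this
  have hF0 : F 0 = 0 := by simp [hF]
  have h1 : |F 1| ≤ K / (1 - a) := by simpa [hF0] using hR 0 (by norm_num)
  have h2 : |F (-1)| ≤ K / (1 - a) := by simpa [hF0] using hL 0 (by norm_num)
  refine ⟨h1, h2, fun x hx => ?_⟩
  have hB : 0 ≤ K / (1 - a) := div_nonneg hK (by linarith)
  have hpow : ∀ y ∈ Ico (0 : ℝ) 1, 1 - y ≤ (1 - y) ^ (1 - a) := fun y hy => by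
    simpa using Real.rpow_le_rpow_of_exponent_ge (x := 1 - y) (by linarith [hy.2])
      (by linarith [hy.1]) (show 1 - a ≤ 1 by linarith)
  -- near either endpoint, the deviation from that endpoint value is `≤ B d ^ (1 - a)`
  have comb : ∀ d p u v w : ℝ, 0 ≤ d → d ≤ 1 → d ≤ p → |u| ≤ K / (1 - a) →
      |v| ≤ K / (1 - a) → |w - u| ≤ K / (1 - a) * p →
      |w - v * d / 2 - u * (2 - d) / 2| ≤ 2 * (K / (1 - a)) * p := by
    intro d p u v w hd hd1 hdp hu hv hw
    have e : w - v * d / 2 - u * (2 - d) / 2 = (w - u) + (u - v) * (d / 2) := by ring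
    have huv : |u - v| ≤ 2 * (K / (1 - a)) := (abs_sub _ _).trans (by linarith)
    rw [e]
    calc _ ≤ |w - u| + |u - v| * (d / 2) := by
          refine (abs_add_le _ _).trans_eq ?_
          rw [abs_mul, abs_of_nonneg (by linarith : 0 ≤ d / 2)]
      _ ≤ K / (1 - a) * p + 2 * (K / (1 - a)) * (p / 2) := by gcongr
      _ = _ := by ring
  rcases le_total 0 x with h0 | h0
  · have := comb (1 - x) ((1 - x) ^ (1 - a)) (F 1) (F (-1)) (F x) (by linarith [hx.2])
      (by linarith) (hpow x ⟨h0, hx.2⟩) h1 h2 (hR x ⟨h0, hx.2⟩)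
    rw [abs_of_nonneg h0]
    convert this using 3
    ring
  · have hx' : -x ∈ Ico (0 : ℝ) 1 := ⟨by linarith, by linarith [hx.1]⟩
    have hl := hL (-x) hx'
    rw [neg_neg] at hl
    have := comb (1 - -x) ((1 - -x) ^ (1 - a)) (F (-1)) (F 1) (F x) (by linarith [hx'.2])
      (by linarith) (hpow (-x) hx') h2 h1 hl
    rw [abs_of_nonpos h0]
    convert this using 2
    ring

theorem log_sq_mul_log_sq_mul_rpow_le {b x : ℝ} (hb : 0 < b) (hb1 : b ≤ 1)
    (hx : x ∈ Ioo (-1 : ℝ) 1) :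
    (Real.log ((1+x)/3))^2 * (Real.log ((1-x)/3))^2 * (1 - |x|) ^ b ≤ 48 / b ^ 2 := by
  have main : ∀ y ∈ Ico (0 : ℝ) 1,
      (Real.log ((1+y)/3))^2 * (Real.log ((1-y)/3))^2 * (1 - y) ^ b ≤ 48 / b ^ 2 := by
    intro y hy
    have hy3 : 0 < (1 - y) / 3 := by linarith [hy.2]
    have h1 : (Real.log ((1+y)/3))^2 ≤ 4 := by
      have hlo := Real.one_sub_inv_le_log_of_pos (x := (1 + y) / 3) (by linarith [hy.1])
      have hhi : Real.log ((1+y)/3) ≤ 0 :=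
        Real.log_nonpos (by linarith [hy.1]) (by linarith [hy.2])
      have : ((1+y)/3)⁻¹ ≤ 3 := by
        rw [inv_div, div_le_iff₀ (by linarith [hy.1])]
        linarith [hy.1]
      nlinarith
    have h2 := (Real.abs_log_mul_self_rpow_lt ((1 - y) / 3) (b / 2) hy3
      (by linarith [hy.1]) (by linarith)).le
    have h3 : (Real.log ((1-y)/3))^2 * ((1 - y) / 3) ^ b ≤ 4 / b ^ 2 := by
      have := pow_le_pow_left₀ (abs_nonneg _) h2 2
      rw [sq_abs, mul_pow, ← Real.rpow_mul_natCast hy3.le] at this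
      rw [show b / 2 * ((2 : ℕ) : ℝ) = b by push_cast; ring] at this
      refine this.trans_eq ?_
      field_simp
      norm_num
    have h4 : (1 - y) ^ b ≤ 3 * ((1 - y) / 3) ^ b := by
      have h3b : (3 : ℝ) ^ b ≤ 3 := by
        simpa using Real.rpow_le_rpow_of_exponent_le (by norm_num : (1 : ℝ) ≤ 3) hb1
      calc (1 - y) ^ b = 3 ^ b * ((1 - y) / 3) ^ b := by
            rw [← Real.mul_rpow (by norm_num) hy3.le]
            congr 1
            ring
        _ ≤ _ := by gcongr
    have h5 : 0 ≤ (1 - y) ^ b := Real.rpow_nonneg (by linarith [hy.2]) _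
    calc (Real.log ((1+y)/3))^2 * (Real.log ((1-y)/3))^2 * (1 - y) ^ b
        ≤ 4 * (Real.log ((1-y)/3))^2 * (3 * ((1 - y) / 3) ^ b) := by gcongr
      _ = 12 * ((Real.log ((1-y)/3))^2 * ((1 - y) / 3) ^ b) := by ring
      _ ≤ 12 * (4 / b ^ 2) := by gcongr
      _ = _ := by ring
  rcases le_total 0 x with h0 | h0
  · rw [abs_of_nonneg h0]
    exact main x ⟨h0, hx.2⟩
  · rw [abs_of_nonpos h0]
    have := main (-x) ⟨by linarith, by linarith [hx.1]⟩
    rw [← sub_neg_eq_add 1 x]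
    rwa [← sub_eq_add_neg, mul_comm (Real.log ((1-x)/3) ^ 2)] at this

theorem le_log_mul_log {x : ℝ} (hx : x ∈ Ioo (-1 : ℝ) 1) :
    (4 - x ^ 2) / 9 ≤ Real.log ((1+x)/3) * Real.log ((1-x)/3) := by
  have h1 := Real.log_le_sub_one_of_pos (x := (1 + x) / 3) (by linarith [hx.1])
  have h2 := Real.log_le_sub_one_of_pos (x := (1 - x) / 3) (by linarith [hx.2])
  nlinarith [hx.1, hx.2]

theorem abs_le_of_log_weight {x u M : ℝ} (hx : x ∈ Ioo (-1 : ℝ) 1)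
    (h : |Real.log ((1+x)/3) * Real.log ((1-x)/3)| * |u| ≤ M) : |u| ≤ 3 * M := by
  have h1 := (le_log_mul_log hx).trans (le_abs_self _)
  have : (1 : ℝ) / 3 ≤ |Real.log ((1+x)/3) * Real.log ((1-x)/3)| := by nlinarith [hx.1, hx.2]
  nlinarith [abs_nonneg u]

theorem abs_le_of_deriv_log_weight {x u M : ℝ} (hx : x ∈ Ioo (-(1:ℝ)/2) (1/2))
    (h : (1-x^2) * (Real.log ((1+x)/3))^2 * (Real.log ((1-x)/3))^2 * |u| ≤ M) :
    |u| ≤ 8 * M := by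
  have h1 := le_log_mul_log (x := x) ⟨by linarith [hx.1], by linarith [hx.2]⟩
  have hx2 : x ^ 2 ≤ 1 / 4 := by nlinarith [hx.1, hx.2]
  have h2 : (5 / 12 : ℝ) ^ 2 ≤ (Real.log ((1+x)/3) * Real.log ((1-x)/3)) ^ 2 :=
    pow_le_pow_left₀ (by norm_num) (by linarith) 2
  have h3 : (1 / 8 : ℝ) ≤ (1-x^2) * (Real.log ((1+x)/3))^2 * (Real.log ((1-x)/3))^2 := by
    rw [mul_assoc, ← mul_pow]
    nlinarith
  nlinarith [abs_nonneg u]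

theorem tendsto_zero_of_log_weight_le {Q : ℝ → ℝ} {c : ℝ}
    (h : ∀ x ∈ Ioo (-1:ℝ) 1,
      (Real.log ((1+x)/3))^2 * (Real.log ((1-x)/3))^2 * |Q x| ≤ c) :
    Tendsto Q (nhdsWithin (1:ℝ) (Ioo (-1:ℝ) 1)) (nhds 0) := by
  have hlim : Tendsto (fun x : ℝ => 9 * c / (Real.log ((1-x)/3))^2)
      (nhdsWithin (1:ℝ) (Ioo (-1:ℝ) 1)) (nhds 0) := by
    have h0 : Tendsto (fun x : ℝ => (1 - x) / 3) (nhdsWithin (1:ℝ) (Ioo (-1:ℝ) 1))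
        (nhdsWithin 0 (Ioi 0)) := by
      refine tendsto_nhdsWithin_iff.2 ⟨?_, ?_⟩
      · have : Tendsto (fun x : ℝ => (1 - x) / 3) (nhds 1) (nhds ((1 - 1) / 3)) :=
          Continuous.tendsto (by fun_prop) 1
        simpa using this.mono_left nhdsWithin_le_nhds
      · filter_upwards [self_mem_nhdsWithin] with x hx
        exact div_pos (sub_pos.2 hx.2) (by norm_num)
    have h1 : Tendsto (fun y : ℝ => y ^ 2) atBot atTop := by
      simpa [Function.comp_def] using
        (tendsto_pow_atTop (α := ℝ) two_ne_zero).comp tendsto_abs_atBot_atTop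
    exact (h1.comp (Real.tendsto_log_nhdsGT_zero.comp h0)).const_div_atTop _
  refine squeeze_zero_norm' ?_ hlim
  filter_upwards [self_mem_nhdsWithin] with x hx
  have hl : Real.log ((1-x)/3) < 0 :=
    Real.log_neg (by linarith [hx.2]) (by linarith [hx.1])
  have hr := Real.log_le_sub_one_of_pos (x := (1 + x) / 3) (by linarith [hx.1])
  have h9 : 1 / 9 ≤ (Real.log ((1+x)/3))^2 := by nlinarith [hx.2]
  rw [Real.norm_eq_abs, le_div_iff₀ (sq_pos_of_neg hl)]
  have hp : 0 ≤ (Real.log ((1-x)/3))^2 * |Q x| := by positivity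
  nlinarith [h x hx]

theorem tendsto_zero_of_log_weight_le' {Q : ℝ → ℝ} {c : ℝ}
    (h : ∀ x ∈ Ioo (-1:ℝ) 1,
      (Real.log ((1+x)/3))^2 * (Real.log ((1-x)/3))^2 * |Q x| ≤ c) :
    Tendsto Q (nhdsWithin (-1:ℝ) (Ioo (-1:ℝ) 1)) (nhds 0) := by
  have hneg : Tendsto (fun x : ℝ => -x) (nhdsWithin (-1:ℝ) (Ioo (-1:ℝ) 1))
      (nhdsWithin 1 (Ioo (-1:ℝ) 1)) := by
    refine tendsto_nhdsWithin_iff.2 ⟨?_, ?_⟩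
    · have : Tendsto (fun x : ℝ => -x) (nhds (-1)) (nhds (- -1)) :=
        continuous_neg.tendsto (-1)
      rw [neg_neg] at this
      exact this.mono_left nhdsWithin_le_nhds
    · filter_upwards [self_mem_nhdsWithin] with x hx
      exact ⟨by linarith [hx.2], by linarith [hx.1]⟩
  have := (tendsto_zero_of_log_weight_le (Q := fun x => Q (-x)) (c := c) fun x hx => ?_).comp hneg
  · simpa [Function.comp_def] using this
  · have := h (-x) ⟨by linarith [hx.2], by linarith [hx.1]⟩
    rwa [sub_neg_eq_add, ← sub_eq_add_neg, mul_comm (Real.log ((1-x)/3) ^ 2)] at this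

theorem triple_integral_bounds {g G H P : ℝ → ℝ} {K a : ℝ} (hK : 0 ≤ K) (ha0 : 0 < a)
    (ha : a < 1) (hg : ContinuousOn g (Ioo (-1) 1))
    (hgK : ∀ s ∈ Ioo (-1 : ℝ) 1, |g s| ≤ K * (1 - |s|) ^ (-(2 + a)))
    (hG : ∀ t, G t = ∫ s in (0:ℝ)..t, g s) (hH : ∀ t, H t = ∫ s in (0:ℝ)..t, G s)
    (hP : ∀ t, P t = ∫ s in (0:ℝ)..t, H s) :
    (∀ x ∈ Ioo (-1 : ℝ) 1, HasDerivAt P (H x) x ∧ HasDerivAt H (G x) x) ∧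
    ContinuousOn P (Icc (-1) 1) ∧
    (∀ x ∈ Ioo (-1 : ℝ) 1, |G x| ≤ K * (1 - |x|) ^ (-(1 + a)) ∧
      |H x| ≤ K / a * (1 - |x|) ^ (-a) ∧
      |P x - P (-1) * (1 - x) / 2 - P 1 * (1 + x) / 2| ≤
        2 * (K / a / (1 - a)) * (1 - |x|) ^ (1 - a)) ∧
    |P 1| ≤ K / a / (1 - a) ∧ |P (-1)| ≤ K / a / (1 - a) := by
  have hGb : ∀ x ∈ Ioo (-1 : ℝ) 1, |G x| ≤ K * (1 - |x|) ^ (-(1 + a)) := by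
    intro x hx
    have h := abs_integral_le_rpow (q := 1 + a) hK (by linarith)
      (fun s hs => (hgK s hs).trans_eq (by ring_nf)) hx
    rw [hG]
    have h1 : 0 ≤ 1 - |x| := by linarith [abs_lt.2 hx]
    exact h.trans (mul_le_mul_of_nonneg_right (div_le_self hK (by linarith))
      (Real.rpow_nonneg h1 _))
  have hHb : ∀ x ∈ Ioo (-1 : ℝ) 1, |H x| ≤ K / a * (1 - |x|) ^ (-a) := by
    intro x hx
    rw [hH]
    exact abs_integral_le_rpow hK ha0 hGb hx
  have dG : ∀ x ∈ Ioo (-1 : ℝ) 1, HasDerivAt G (g x) x := fun x hx => by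
    rw [funext hG]
    exact hasDerivAt_integral_of_continuousOn_Ioo hg hx
  have dH : ∀ x ∈ Ioo (-1 : ℝ) 1, HasDerivAt H (G x) x := fun x hx => by
    rw [funext hH]
    exact hasDerivAt_integral_of_continuousOn_Ioo
      (fun y hy => (dG y hy).continuousAt.continuousWithinAt) hx
  have cH : ContinuousOn H (Ioo (-1) 1) :=
    fun y hy => (dH y hy).continuousAt.continuousWithinAt
  have dP : ∀ x ∈ Ioo (-1 : ℝ) 1, HasDerivAt P (H x) x := fun x hx => by
    rw [funext hP]
    exact hasDerivAt_integral_of_continuousOn_Ioo cH hx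
  have hKa : 0 ≤ K / a := by positivity
  have hi := intervalIntegrable_of_le_rpow hKa ha cH hHb
  obtain ⟨b1, b2, b3⟩ := abs_sub_linear_interpolation_le hKa ha0.le ha hi hHb hP
  refine ⟨fun x hx => ⟨dP x hx, dH x hx⟩, ?_,
    fun x hx => ⟨hGb x hx, hHb x hx, b3 x hx⟩, b1, b2⟩
  rw [funext hP, ← uIcc_of_le (by norm_num : (-1 : ℝ) ≤ 1)]
  exact intervalIntegral.continuousOn_primitive_interval' hi (by norm_num [mem_uIcc])

theorem abs_mul_div_le_rpow {ε s u v MU MV : ℝ} (hε : 0 < ε) (hs : s ∈ Ioo (-1 : ℝ) 1)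
    (hu : (1-s^2) ^ ε * |u| ≤ MU) (hv : (1-s^2) ^ (1+ε) * |v| ≤ MV) :
    |2 * u * v / (1-s^2)| ≤ 2 * (MU * MV) * (1 - |s|) ^ (-(2 + 2 * ε)) := by
  have hs1 : |s| < 1 := abs_lt.2 hs
  have hw : 1 - |s| ≤ 1 - s ^ 2 := by nlinarith [abs_nonneg s, sq_abs s]
  have hw0 : 0 < 1 - s ^ 2 := by linarith
  have hp : 0 ≤ (1 - s ^ 2) ^ ε * |u| := by positivity
  have hprod := mul_le_mul hu hv (by positivity) (hp.trans hu)
  have hM : 0 ≤ MU * MV := le_trans (by positivity) hprod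
  have key : |2 * u * v / (1-s^2)| * (1 - s^2) ^ (2 + 2 * ε) ≤ 2 * (MU * MV) := by
    rw [show 2 + 2 * ε = 1 + (ε + (1 + ε)) by ring, Real.rpow_add hw0, Real.rpow_one,
      Real.rpow_add hw0, abs_div, abs_mul, abs_mul, abs_of_pos hw0, abs_two]
    calc _ = 2 * ((1 - s ^ 2) ^ ε * |u| * ((1 - s ^ 2) ^ (1 + ε) * |v|)) := by field_simp
      _ ≤ _ := by linarith
  calc |2 * u * v / (1-s^2)| ≤ 2 * (MU * MV) * (1 - s^2) ^ (-(2 + 2 * ε)) := by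
        rw [Real.rpow_neg hw0.le, ← div_eq_mul_inv, le_div_iff₀ (by positivity)]
        exact key
    _ ≤ _ := mul_le_mul_of_nonneg_left
        (Real.rpow_le_rpow_of_nonpos (by linarith) hw (by linarith)) (by linarith)

theorem log_sq_mul_log_sq_mul_abs_add_le {b B D N MU MV x u v r : ℝ} (hx : x ∈ Ioo (-1 : ℝ) 1)
    (hb : 0 < b) (hb1 : b ≤ 1) (hB : 0 ≤ B)
    (hu : |Real.log ((1+x)/3) * Real.log ((1-x)/3)| * |u| ≤ MU)
    (hv : |Real.log ((1+x)/3) * Real.log ((1-x)/3)| * |v| ≤ MV)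
    (hr : |r| ≤ B * (1 - |x|) ^ b) (hD : |D| ≤ N) :
    (Real.log ((1+x)/3))^2 * (Real.log ((1-x)/3))^2 * |u * v / 2 + r + D * (1-x^2) / 4| ≤
      MU * MV / 2 + 48 * B / b ^ 2 + 24 * N := by
  have hx1 : |x| < 1 := abs_lt.2 hx
  have hx2 : 0 ≤ 1 - x ^ 2 := by nlinarith [hx.1, hx.2]
  obtain ⟨L, hL⟩ : ∃ L, L = (Real.log ((1+x)/3))^2 * (Real.log ((1-x)/3))^2 := ⟨_, rfl⟩
  have hL0 : 0 ≤ L := by rw [hL]; positivity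
  have l1 : L * (1 - |x|) ^ b ≤ 48 / b ^ 2 := hL ▸ log_sq_mul_log_sq_mul_rpow_le hb hb1 hx
  have l2 : L * (1 - |x|) ≤ 48 := by
    simpa [hL] using log_sq_mul_log_sq_mul_rpow_le one_pos le_rfl hx
  have t1 : L * |u * v| ≤ MU * MV := by
    refine le_trans (le_of_eq ?_)
      (mul_le_mul hu hv (by positivity) (le_trans (by positivity) hu))
    rw [hL, abs_mul, ← mul_pow, ← sq_abs]
    ring
  have t2 : L * |r| ≤ 48 * B / b ^ 2 := by
    calc _ ≤ L * (B * (1 - |x|) ^ b) := by gcongr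
      _ = B * (L * (1 - |x|) ^ b) := by ring
      _ ≤ B * (48 / b ^ 2) := by gcongr
      _ = _ := by ring
  have t3 : L * |D * (1-x^2)| ≤ 96 * N := by
    have hx3 : 1 - x ^ 2 ≤ 2 * (1 - |x|) := by nlinarith [abs_nonneg x, sq_abs x]
    rw [abs_mul, abs_of_nonneg hx2]
    calc _ = |D| * (L * (1 - x ^ 2)) := by ring
      _ ≤ N * (L * (2 * (1 - |x|))) :=
        mul_le_mul hD (by gcongr) (by positivity) ((abs_nonneg D).trans hD)
      _ = 2 * N * (L * (1 - |x|)) := by ring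
      _ ≤ _ := by nlinarith [(abs_nonneg D).trans hD]
  have e : |u * v / 2 + r + D * (1-x^2) / 4| ≤
      |u * v| / 2 + |r| + |D * (1-x^2)| / 4 := by
    refine (abs_add_three _ _ _).trans_eq ?_
    rw [abs_div, abs_div, abs_two, abs_of_pos (by norm_num : (0:ℝ) < 4)]
  rw [← hL]
  linarith [mul_le_mul_of_nonneg_left e hL0]

theorem one_sub_abs_rpow_neg_le {x p n : ℝ} (hx : x ∈ Ioo (-(1:ℝ)/2) (1/2)) (hp : 0 ≤ p)
    (hpn : p ≤ n) : (1 - |x|) ^ (-p) ≤ 2 ^ n := by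
  have h2 : 1 / 2 ≤ 1 - |x| := by
    linarith [(abs_lt (a := x) (b := 1 / 2)).2 ⟨by linarith [hx.1], hx.2⟩]
  calc (1 - |x|) ^ (-p) ≤ (1 / 2) ^ (-p) :=
        Real.rpow_le_rpow_of_nonpos (by norm_num) h2 (by linarith)
    _ = 2 ^ p := by rw [one_div, Real.inv_rpow (by norm_num), Real.rpow_neg (by norm_num), inv_inv]
    _ ≤ 2 ^ n := Real.rpow_le_rpow_of_exponent_le (by norm_num) hpn

theorem abs_mul_le_mul_of_abs_le {u v p q MU MV : ℝ} (hp : 0 ≤ p * MU) (hu : |u| ≤ p * MU)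
    (hv : |v| ≤ q * MV) : |u * v| ≤ p * q * (MU * MV) := by
  rw [abs_mul]
  exact (mul_le_mul hu hv (abs_nonneg _) hp).trans_eq (by ring)

/-- the bilinear operator `Q = (Qθ, Qφ)` (as in Statement 5) maps the
doubly-log-weighted space `X × X` boundedly into the doubly-log-weighted `Y`,
with `Qθ → 0` at `±1` and `Qθ''(0) = 0`. -/
theorem stmt9 (ε : ℝ) (hε : 0 < ε) (hε2 : ε < 1/2) :
    ∃ C > 0,
      ∀ (Ut Ut' Ut'' Ut''' Vt Vt' Vt'' Vt''' Uφ Uφ' Uφ'' Vφ Vφ' Vφ'' : ℝ → ℝ)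
        (MU MV : ℝ),
      (∀ x ∈ Ioo (-1:ℝ) 1, HasDerivAt Ut (Ut' x) x) →
      (∀ x ∈ Ioo (-(1:ℝ)/2) (1/2), HasDerivAt Ut' (Ut'' x) x) →
      (∀ x ∈ Ioo (-(1:ℝ)/2) (1/2), HasDerivAt Ut'' (Ut''' x) x) →
      (∀ x ∈ Ioo (-1:ℝ) 1, HasDerivAt Vt (Vt' x) x) →
      (∀ x ∈ Ioo (-(1:ℝ)/2) (1/2), HasDerivAt Vt' (Vt'' x) x) →
      (∀ x ∈ Ioo (-(1:ℝ)/2) (1/2), HasDerivAt Vt'' (Vt''' x) x) →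
      (∀ x ∈ Ioo (-1:ℝ) 1, HasDerivAt Uφ (Uφ' x) x) →
      (∀ x ∈ Ioo (-1:ℝ) 1, HasDerivAt Uφ' (Uφ'' x) x) →
      (∀ x ∈ Ioo (-1:ℝ) 1, HasDerivAt Vφ (Vφ' x) x) →
      (∀ x ∈ Ioo (-1:ℝ) 1, HasDerivAt Vφ' (Vφ'' x) x) →
      -- finite doubly-log M₁-norms bounded by MU, MV
      (∀ x ∈ Ioo (-1:ℝ) 1,
        |Real.log ((1+x)/3) * Real.log ((1-x)/3)| * |Ut x| ≤ MU ∧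
        (1-x^2) * (Real.log ((1+x)/3))^2 * (Real.log ((1-x)/3))^2 * |Ut' x| ≤ MU) →
      (∀ x ∈ Ioo (-(1:ℝ)/2) (1/2), |Ut'' x| ≤ MU ∧ |Ut''' x| ≤ MU) →
      (∀ x ∈ Ioo (-1:ℝ) 1,
        |Real.log ((1+x)/3) * Real.log ((1-x)/3)| * |Vt x| ≤ MV ∧
        (1-x^2) * (Real.log ((1+x)/3))^2 * (Real.log ((1-x)/3))^2 * |Vt' x| ≤ MV) →
      (∀ x ∈ Ioo (-(1:ℝ)/2) (1/2), |Vt'' x| ≤ MV ∧ |Vt''' x| ≤ MV) →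
      -- finite M₂-norms bounded by MU, MV
      (∀ x ∈ Ioo (-1:ℝ) 1,
        (1-x^2) ^ ε * |Uφ x| ≤ MU ∧ (1-x^2) ^ (1+ε) * |Uφ' x| ≤ MU ∧
          (1-x^2) ^ (2+ε) * |Uφ'' x| ≤ MU) →
      (∀ x ∈ Ioo (-1:ℝ) 1,
        (1-x^2) ^ ε * |Vφ x| ≤ MV ∧ (1-x^2) ^ (1+ε) * |Vφ' x| ≤ MV ∧
          (1-x^2) ^ (2+ε) * |Vφ'' x| ≤ MV) →
      (let ψ : ℝ → ℝ := fun x =>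
        ∫ l in (0:ℝ)..x, ∫ t in (0:ℝ)..l, ∫ s in (0:ℝ)..t, 2 * Uφ s * Vφ' s / (1-s^2)
       ∃ Ψ : ℝ → ℝ, ContinuousOn Ψ (Icc (-1:ℝ) 1) ∧
        (∀ x ∈ Ioo (-1:ℝ) 1, Ψ x = ψ x) ∧
        (let Qθ : ℝ → ℝ := fun x =>
          Ut x * Vt x / 2 + ψ x - Ψ (-1) * (1-x) / 2 - Ψ 1 * (1+x) / 2
            + deriv (deriv (fun y => Ut y * Vt y)) 0 * (1-x^2) / 4
         let Qφ : ℝ → ℝ := fun x => Ut x * Vφ' x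
         Tendsto Qθ (nhdsWithin (-1:ℝ) (Ioo (-1:ℝ) 1)) (nhds 0) ∧
         Tendsto Qθ (nhdsWithin (1:ℝ) (Ioo (-1:ℝ) 1)) (nhds 0) ∧
         deriv (deriv Qθ) 0 = 0 ∧
         (∀ x ∈ Ioo (-1:ℝ) 1,
           (Real.log ((1+x)/3))^2 * (Real.log ((1-x)/3))^2 * |Qθ x| ≤ C * MU * MV) ∧
         (∀ x ∈ Ioo (-(1:ℝ)/2) (1/2),
           |deriv Qθ x| ≤ C * MU * MV ∧ |deriv (deriv Qθ) x| ≤ C * MU * MV) ∧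
         (∀ x ∈ Ioo (-1:ℝ) 1, (1-x^2) ^ (1+ε) * |Qφ x| ≤ C * MU * MV))) := by
  have ha : 2 * ε < 1 := by linarith
  have hb0 : 0 < 1 - 2 * ε := by linarith
  obtain ⟨T, hT⟩ : ∃ T, T = 1 / (2 * ε * (1 - 2 * ε) ^ 3) := ⟨_, rfl⟩
  have hT0 : 0 < T := by rw [hT]; positivity
  have hTB : 1 / (2 * ε) / (1 - 2 * ε) ≤ T := by
    rw [hT, div_div]
    exact one_div_le_one_div_of_le (by positivity) (mul_le_mul_of_nonneg_left
      (pow_le_of_le_one hb0.le (by linarith) three_ne_zero) (by linarith))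
  have hTa : 1 / (2 * ε) ≤ T :=
    le_trans (le_div_self (by positivity) hb0 (by linarith)) hTB
  refine ⟨4000 + 200 * T, by positivity, ?_⟩
  intro Ut Ut' Ut'' Ut''' Vt Vt' Vt'' Vt''' Uφ Uφ' Uφ'' Vφ Vφ' Vφ'' MU MV
    dU dU' _ dV dV' _ dUφ _ _ dVφ' bU bU2 bV bV2 bUφ bVφ ψ
  have half : ∀ x ∈ Ioo (-(1:ℝ)/2) (1/2), x ∈ Ioo (-1:ℝ) 1 :=
    fun x hx => ⟨by linarith [hx.1], by linarith [hx.2]⟩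
  have m0 : (0:ℝ) ∈ Ioo (-(1:ℝ)/2) (1/2) := by norm_num
  have hMU : 0 ≤ MU := le_trans (by positivity) (bU 0 (half 0 m0)).1
  have hMV : 0 ≤ MV := le_trans (by positivity) (bV 0 (half 0 m0)).1
  obtain ⟨M, hM⟩ : ∃ M, M = MU * MV := ⟨_, rfl⟩
  have hM0 : 0 ≤ M := hM ▸ mul_nonneg hMU hMV
  obtain ⟨G, hG⟩ : ∃ G : ℝ → ℝ, ∀ t, G t = ∫ s in (0:ℝ)..t, 2 * Uφ s * Vφ' s / (1-s^2) :=
    ⟨_, fun _ => rfl⟩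
  obtain ⟨H, hH⟩ : ∃ H : ℝ → ℝ, ∀ t, H t = ∫ s in (0:ℝ)..t, G s := ⟨_, fun _ => rfl⟩
  have hψ : ∀ t, ψ t = ∫ s in (0:ℝ)..t, H s := fun t => by simp only [ψ, hH, hG]
  have hg : ContinuousOn (fun s => 2 * Uφ s * Vφ' s / (1-s^2)) (Ioo (-1) 1) := by
    intro s hs
    refine ContinuousAt.continuousWithinAt (.div
      ((continuousAt_const.mul (dUφ s hs).continuousAt).mul (dVφ' s hs).continuousAt)
      (by fun_prop) ?_)
    nlinarith [hs.1, hs.2]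
  obtain ⟨dψ, cψ, bψ, b1, b2⟩ := triple_integral_bounds (K := 2 * M) (a := 2 * ε)
    (by linarith) (by linarith) ha hg
    (fun s hs => hM ▸ abs_mul_div_le_rpow hε hs (bUφ s hs).1 (bVφ s hs).2.1) hG hH hψ
  have hB : 2 * M / (2 * ε) / (1 - 2 * ε) ≤ 2 * M * T := by
    calc _ = 2 * M * (1 / (2 * ε) / (1 - 2 * ε)) := by ring
      _ ≤ _ := by gcongr
  have bu0 : ∀ x ∈ Ioo (-1:ℝ) 1, |Ut x| ≤ 3 * MU :=
    fun x hx => abs_le_of_log_weight hx (bU x hx).1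
  have bv0 : ∀ x ∈ Ioo (-1:ℝ) 1, |Vt x| ≤ 3 * MV :=
    fun x hx => abs_le_of_log_weight hx (bV x hx).1
  have bu1 : ∀ x ∈ Ioo (-(1:ℝ)/2) (1/2), |Ut' x| ≤ 8 * MU :=
    fun x hx => abs_le_of_deriv_log_weight hx (bU x (half x hx)).2
  have bv1 : ∀ x ∈ Ioo (-(1:ℝ)/2) (1/2), |Vt' x| ≤ 8 * MV :=
    fun x hx => abs_le_of_deriv_log_weight hx (bV x (half x hx)).2
  obtain ⟨W1, hW1⟩ : ∃ W1 : ℝ → ℝ, ∀ x, W1 x = Ut' x * Vt x + Ut x * Vt' x := ⟨_, fun _ => rfl⟩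
  obtain ⟨W2, hW2⟩ : ∃ W2 : ℝ → ℝ, ∀ x, W2 x = (Ut'' x * Vt x + Ut' x * Vt' x) +
    (Ut' x * Vt' x + Ut x * Vt'' x) := ⟨_, fun _ => rfl⟩
  have dW : ∀ x ∈ Ioo (-1:ℝ) 1, HasDerivAt (fun y => Ut y * Vt y) (W1 x) x :=
    fun x hx => hW1 x ▸ (dU x hx).mul (dV x hx)
  have dW1 : ∀ x ∈ Ioo (-(1:ℝ)/2) (1/2), HasDerivAt W1 (W2 x) x := fun x hx => by
    rw [funext hW1, hW2]
    exact ((dU' x hx).mul (dV x (half x hx))).add ((dU x (half x hx)).mul (dV' x hx))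
  have bW1 : ∀ x ∈ Ioo (-(1:ℝ)/2) (1/2), |W1 x| ≤ 48 * M := fun x hx => by
    have h1 := abs_mul_le_mul_of_abs_le (by positivity) (bu1 x hx) (bv0 x (half x hx))
    have h2 := abs_mul_le_mul_of_abs_le (by positivity) (bu0 x (half x hx)) (bv1 x hx)
    rw [hW1]
    exact (abs_add_le _ _).trans (by linarith)
  have bW2 : ∀ x ∈ Ioo (-(1:ℝ)/2) (1/2), |W2 x| ≤ 134 * M := fun x hx => by
    have h1 := abs_mul_le_mul_of_abs_le (by positivity)
      ((bU2 x hx).1.trans_eq (one_mul MU).symm) (bv0 x (half x hx))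
    have h2 := abs_mul_le_mul_of_abs_le (by positivity) (bu0 x (half x hx))
      ((bV2 x hx).1.trans_eq (one_mul MV).symm)
    have h3 := abs_mul_le_mul_of_abs_le (by positivity) (bu1 x hx) (bv1 x hx)
    rw [hW2]
    have e1 := abs_add_le (Ut'' x * Vt x) (Ut' x * Vt' x)
    have e2 := abs_add_le (Ut' x * Vt' x) (Ut x * Vt'' x)
    exact (abs_add_le _ _).trans (by linarith)
  have hD : deriv (deriv (fun y => Ut y * Vt y)) 0 = W2 0 := by
    have : deriv (fun y => Ut y * Vt y) =ᶠ[nhds 0] W1 := by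
      filter_upwards [isOpen_Ioo.mem_nhds m0] with y hy using (dW y (half y hy)).deriv
    rw [this.deriv_eq]
    exact (dW1 0 m0).deriv
  refine ⟨ψ, cψ, fun x _ => rfl, ?_⟩
  intro Qθ Qφ
  have hQ : ∀ x, Qθ x = Ut x * Vt x / 2 + ψ x - ψ (-1) * (1-x) / 2 - ψ 1 * (1+x) / 2
      + W2 0 * (1-x^2) / 4 := fun x => by simp only [Qθ, hD]
  have dQ : ∀ x ∈ Ioo (-(1:ℝ)/2) (1/2), deriv Qθ x =
      W1 x / 2 + H x + (ψ (-1) - ψ 1) / 2 - W2 0 * x / 2 := fun x hx => by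
    rw [funext hQ]
    have h1 : HasDerivAt (fun x => ψ (-1) * (1-x) / 2) (ψ (-1) * (-1) / 2) x :=
      (((hasDerivAt_id x).const_sub 1).const_mul _).div_const 2
    have h2 : HasDerivAt (fun x => ψ 1 * (1+x) / 2) (ψ 1 * 1 / 2) x :=
      (((hasDerivAt_id x).const_add 1).const_mul _).div_const 2
    have h3 : HasDerivAt (fun x => W2 0 * (1-x^2) / 4) (W2 0 * (-(2 * x)) / 4) x := by
      simpa using (((hasDerivAt_pow 2 x).const_sub 1).const_mul (W2 0)).div_const 4
    exact ((((((dW x (half x hx)).div_const 2).add (dψ x (half x hx)).1).sub h1).sub h2).add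
      h3).congr_deriv (by ring) |>.deriv
  have ddQ : ∀ x ∈ Ioo (-(1:ℝ)/2) (1/2), deriv (deriv Qθ) x =
      W2 x / 2 + G x - W2 0 / 2 := fun x hx => by
    have h0 : deriv Qθ =ᶠ[nhds x] fun x =>
        W1 x / 2 + H x + (ψ (-1) - ψ 1) / 2 - W2 0 * x / 2 := by
      filter_upwards [isOpen_Ioo.mem_nhds hx] with y hy using dQ y hy
    have h1 : HasDerivAt (fun x => W2 0 * x / 2) (W2 0 * 1 / 2) x :=
      ((hasDerivAt_id x).const_mul _).div_const 2
    rw [h0.deriv_eq]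
    exact (((((dW1 x hx).div_const 2).add (dψ x (half x hx)).2).add_const
      ((ψ (-1) - ψ 1) / 2)).sub h1).congr_deriv (by ring) |>.deriv
  have hweight : ∀ x ∈ Ioo (-1:ℝ) 1,
      (Real.log ((1+x)/3))^2 * (Real.log ((1-x)/3))^2 * |Qθ x| ≤ (4000 + 200 * T) * MU * MV := by
    intro x hx
    have hTM : 0 ≤ T * M := by positivity
    have h := log_sq_mul_log_sq_mul_abs_add_le hx hb0 (by linarith) (by positivity)
      (bU x hx).1 (bV x hx).1 (bψ x hx).2.2 (bW2 0 m0)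
    have e : Qθ x = Ut x * Vt x / 2 + (ψ x - ψ (-1) * (1 - x) / 2 - ψ 1 * (1 + x) / 2) +
        W2 0 * (1-x^2) / 4 := by rw [hQ]; ring
    have eT : 48 * (2 * (2 * M / (2 * ε) / (1 - 2 * ε))) / (1 - 2 * ε) ^ 2 = 192 * (T * M) := by
      rw [hT]
      field_simp
      ring
    rw [← e, eT, ← hM] at h
    rw [mul_assoc _ MU, ← hM]
    linarith
  refine ⟨tendsto_zero_of_log_weight_le' hweight, tendsto_zero_of_log_weight_le hweight,
    ?_, hweight, ?_, ?_⟩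
  · rw [ddQ 0 m0, hG, intervalIntegral.integral_same]
    ring
  · intro x hx
    have hTM : 0 ≤ T * M := by positivity
    obtain ⟨bG, bH, -⟩ := bψ x (half x hx)
    have hD0 := abs_le.1 (bW2 0 m0)
    have h1 := abs_le.1 (bW1 x hx)
    have h2 := abs_le.1 (bW2 x hx)
    have hGx : |G x| ≤ 8 * M := by
      have h : (1 - |x|) ^ (-(1 + 2 * ε)) ≤ 4 :=
        (one_sub_abs_rpow_neg_le (n := 2) hx (by linarith) (by linarith)).trans_eq (by norm_num)
      calc |G x| ≤ 2 * M * 4 := bG.trans (by gcongr)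
        _ = 8 * M := by ring
    have hHx : |H x| ≤ 4 * (T * M) := by
      have h := one_sub_abs_rpow_neg_le (n := 1) hx (by linarith : 0 ≤ 2 * ε) (by linarith)
      rw [Real.rpow_one] at h
      calc |H x| ≤ 2 * M / (2 * ε) * 2 := bH.trans (by gcongr)
        _ = 4 * (1 / (2 * ε) * M) := by ring
        _ ≤ _ := by gcongr
    have hDx : |W2 0 * x| ≤ 134 * M := by
      rw [abs_mul]
      have : |x| ≤ 1 := (abs_lt.2 (half x hx)).le
      nlinarith [bW2 0 m0, abs_nonneg (W2 0)]
    have hGx := abs_le.1 hGx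
    have hHx := abs_le.1 hHx
    have hDx := abs_le.1 hDx
    have b1 := abs_le.1 (b1.trans hB)
    have b2 := abs_le.1 (b2.trans hB)
    rw [mul_assoc _ MU, ← hM, dQ x hx, ddQ x hx]
    constructor <;> rw [abs_le] <;> constructor <;> linarith
  · intro x hx
    have h := mul_le_mul (bu0 x hx) (bVφ x hx).2.1
      (mul_nonneg (Real.rpow_nonneg (by nlinarith [hx.1, hx.2]) _) (abs_nonneg _))
      (by positivity)
    have hTM : 0 ≤ T * M := by positivity
    rw [mul_assoc _ MU, ← hM, abs_mul]
    calc _ = |Ut x| * ((1 - x ^ 2) ^ (1 + ε) * |Vφ' x|) := by ring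
      _ ≤ 3 * M := h.trans_eq (by rw [hM]; ring)
      _ ≤ _ := by linarith
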